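/- arXiv:cs/0201019 — 2 statements merged into one kernel-verified Lean document; each statement's English description precedes it below -/
import Mathlib

section
/- The structure-from-motion transformations are closed under composition with an explicit composition law: let n ∈ ℕ, let R, R′ ∈ SO(3), T, T′ ∈ ℝ³ and λ₁,…,λₙ, λ′₁,…,λ′ₙ ∈ ℝ, and let g(R,T,λ) denote the map sending (P₀, P₁, …, Pₙ) ∈ (ℝ³)^{n+1} to (R P₀ + T, R(P₁ + λ₁(P₁ − P₀)) + T, …, R(Pₙ + λₙ(Pₙ − P₀)) + T). Then g(R′,T′,λ′) ∘ g(R,T,λ) = g(R′R, R′T + T′, λ″), where λ″ᵢ = λᵢ + λ′ᵢ + λᵢλ′ᵢ (equivalently, 1 + λ″ᵢ = (1 + λᵢ)(1 + λ′ᵢ)) for i = 1, …, n. -/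
open Matrix

/-- The structure-from-motion transformation with rotation `R`, translation `T` and
depth factors `lam i`: it sends `(P₀, (Pᵢ)ᵢ)` to
`(R P₀ + T, (R (Pᵢ + lam i (Pᵢ - P₀)) + T)ᵢ)`. -/
def sfmMap (n : ℕ) (R : Matrix (Fin 3) (Fin 3) ℝ) (T : Fin 3 → ℝ) (lam : Fin n → ℝ) :
    (Fin 3 → ℝ) × (Fin n → Fin 3 → ℝ) → (Fin 3 → ℝ) × (Fin n → Fin 3 → ℝ) :=
  fun P => (R *ᵥ P.1 + T, fun i => R *ᵥ (P.2 i + lam i • (P.2 i - P.1)) + T)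

/-- **Closure of the structure-from-motion transformations under composition.**
For `R, R' ∈ SO(3)`, `T, T' ∈ ℝ³` and depth factors `λ, λ'`,
`g(R', T', λ') ∘ g(R, T, λ) = g(R' R, R' T + T', λ'')` where
`λ''ᵢ = λᵢ + λ'ᵢ + λᵢ λ'ᵢ`. -/
theorem sfmMap_comp (n : ℕ) (R R' : Matrix (Fin 3) (Fin 3) ℝ)
    (hR : R ∈ Matrix.specialOrthogonalGroup (Fin 3) ℝ)
    (hR' : R' ∈ Matrix.specialOrthogonalGroup (Fin 3) ℝ)
    (T T' : Fin 3 → ℝ) (lam lam' : Fin n → ℝ) :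
    sfmMap n R' T' lam' ∘ sfmMap n R T lam
      = sfmMap n (R' * R) (R' *ᵥ T + T') (fun i => lam i + lam' i + lam i * lam' i) := by
  funext P
  refine Prod.ext ?_ (funext fun i => ?_)
  · simp only [sfmMap, Function.comp_apply, mulVec_add, mulVec_mulVec, add_assoc]
  · simp only [sfmMap, Function.comp_apply, mulVec_add, mulVec_sub, mulVec_smul, mulVec_mulVec]
    module
end

section
/- The focal-length transformation preserves distance to the camera center and commutes with the depth-factor action: let P₀, P_M, P ∈ ℝ³ and α ∈ ℝ, set m = P_M − P₀ and v = P − P₀, and assume v · m ≠ 0 and u := v/(v · m) + α m ≠ 0. Define F_α(P) = P₀ + ‖v‖ · u/‖u‖. Then (a) ‖F_α(P) − P₀‖ = ‖P − P₀‖; and (b) for every λ > −1, the point P_λ = P₀ + (1 + λ)(P − P₀) also satisfies the hypotheses (with the same P₀, P_M, α) and F_α(P_λ) = P₀ + (1 + λ)(F_α(P) − P₀), i.e. applying the depth scaling by factor (1 + λ) and then the focal-length transformation gives the same point as applying them in the opposite order. -/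
open Matrix

/-- The Euclidean norm of a vector of `ℝ³`. -/
noncomputable def norm3 (v : Fin 3 → ℝ) : ℝ := Real.sqrt (v ⬝ᵥ v)

/-- The focal-length transformation with camera center `P₀`, image-plane foot `PM`
and parameter `α`: it sends `P` to `P₀ + ‖v‖ • u/‖u‖` with `v = P - P₀` and
`u = v/(v ⬝ᵥ m) + α • m`, `m = PM - P₀`. -/
noncomputable def focalMap (P₀ PM : Fin 3 → ℝ) (α : ℝ) (P : Fin 3 → ℝ) : Fin 3 → ℝ :=
  P₀ + (norm3 (P - P₀) / norm3 ((1 / ((P - P₀) ⬝ᵥ (PM - P₀))) • (P - P₀)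
      + α • (PM - P₀))) •
    ((1 / ((P - P₀) ⬝ᵥ (PM - P₀))) • (P - P₀) + α • (PM - P₀))

theorem norm3_smul (c : ℝ) (w : Fin 3 → ℝ) : norm3 (c • w) = |c| * norm3 w := by
  rw [norm3, norm3, smul_dotProduct, dotProduct_smul, smul_smul, smul_eq_mul,
    Real.sqrt_mul (mul_self_nonneg c), Real.sqrt_mul_self_eq_abs]

theorem norm3_nonneg (w : Fin 3 → ℝ) : 0 ≤ norm3 w := Real.sqrt_nonneg _

theorem norm3_pos {w : Fin 3 → ℝ} (hw : w ≠ 0) : 0 < norm3 w := by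
  refine Real.sqrt_pos.mpr (lt_of_le_of_ne ?_ fun h => hw (dotProduct_self_eq_zero.mp h.symm))
  exact Finset.sum_nonneg fun i _ => mul_self_nonneg (w i)

theorem one_div_dotProduct_smul_smul {c : ℝ} (hc : c ≠ 0) (v m : Fin 3 → ℝ) :
    (1 / ((c • v) ⬝ᵥ m)) • (c • v) = (1 / (v ⬝ᵥ m)) • v := by
  rw [smul_dotProduct, smul_eq_mul, smul_smul, one_div, _root_.mul_inv_rev, mul_assoc,
    inv_mul_cancel₀ hc, mul_one, one_div]

/-- **The focal-length transformation preserves the distance to the camera center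
and commutes with the depth-factor action.**  Assume `v ⬝ᵥ m ≠ 0` and
`u = v/(v ⬝ᵥ m) + α m ≠ 0`, with `v = P - P₀`, `m = PM - P₀`.  Then
(a) `‖F_α(P) - P₀‖ = ‖P - P₀‖`, and (b) for every `λ > -1` the rescaled point
`P_λ = P₀ + (1+λ)(P - P₀)` also satisfies the hypotheses, and
`F_α(P_λ) = P₀ + (1+λ)(F_α(P) - P₀)`. -/
theorem focalMap_norm_and_comm (P₀ PM P : Fin 3 → ℝ) (α : ℝ)
    (m v : Fin 3 → ℝ) (hm : m = PM - P₀) (hv : v = P - P₀)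
    (hvm : v ⬝ᵥ m ≠ 0) (hu : (1 / (v ⬝ᵥ m)) • v + α • m ≠ 0) :
    norm3 (focalMap P₀ PM α P - P₀) = norm3 (P - P₀) ∧
    ∀ l : ℝ, l > -1 →
      ((P₀ + (1 + l) • (P - P₀) - P₀) ⬝ᵥ m ≠ 0 ∧
       (1 / ((P₀ + (1 + l) • (P - P₀) - P₀) ⬝ᵥ m)) • (P₀ + (1 + l) • (P - P₀) - P₀)
          + α • m ≠ 0 ∧
       focalMap P₀ PM α (P₀ + (1 + l) • (P - P₀))
          = P₀ + (1 + l) • (focalMap P₀ PM α P - P₀)) := by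
  subst hm hv
  refine ⟨?_, fun l hl => ?_⟩
  · rw [focalMap, add_sub_cancel_left, norm3_smul,
      abs_of_nonneg (div_nonneg (norm3_nonneg _) (norm3_nonneg _)),
      div_mul_cancel₀ _ (norm3_pos hu).ne']
  · have hc : 0 < 1 + l := by linarith
    simp only [focalMap, add_sub_cancel_left, one_div_dotProduct_smul_smul hc.ne']
    refine ⟨?_, hu, ?_⟩
    · rw [smul_dotProduct, smul_eq_mul]
      exact mul_ne_zero hc.ne' hvm
    · rw [norm3_smul, abs_of_pos hc, mul_div_assoc, mul_smul]
end
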